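/- Let m > n ≥ 1, let π ∈ S_n, and let π′ ∈ S_m be the permutation with an increasing tail defined by π′_j = π_j for 1 ≤ j ≤ n and π′_j = j for n+1 ≤ j ≤ m. Then the fibers of the MVP outcome maps over π′ and over π have the same cardinality: |O_m^{-1}(π′)| = |O_n^{-1}(π)|. -/

import Mathlib

open Finset

namespace MVPPark

/-- One step of the MVP parking process: car `c`, preferring spot `p`, arrives at the
state `state` (recording, for each spot, the car parked there, if any).  Car `c` always
parks in spot `p`; if spot `p` was occupied by an (earlier) car `j`, then `j` is bumped
and parks in the first unoccupied spot strictly beyond `p`, if such a spot exists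
(otherwise `j` drives off unparked). -/
def mvpStep {n : ℕ} (state : Fin n → Option (Fin n)) (c p : Fin n) :
    Fin n → Option (Fin n) :=
  match state p with
  | none => Function.update state p (some c)
  | some j =>
    match (List.finRange n).find? (fun k => decide (p < k) && (state k).isNone) with
    | none => Function.update state p (some c)
    | some k => Function.update (Function.update state p (some c)) k (some j)

/-- The final state of the MVP parking process with preference list `α`:
cars `0, 1, …, n-1` enter in order, car `i` preferring spot `α i`. -/
def mvpRun {n : ℕ} (α : Fin n → Fin n) : Fin n → Option (Fin n) :=
  (List.finRange n).foldl (fun st c => mvpStep st c (α c)) (fun _ => none)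

/-- `α` is an MVP parking function: under the MVP rule, all `n` cars end up parked. -/
def IsMVP {n : ℕ} (α : Fin n → Fin n) : Prop :=
  ∀ c : Fin n, ∃ j : Fin n, mvpRun α j = some c

/-- The outcome of the MVP parking process on `α` is the permutation `π`:
for each `j`, spot `j` ends up occupied by car `π j`. -/
def MvpOutcome {n : ℕ} (α : Fin n → Fin n) (π : Equiv.Perm (Fin n)) : Prop :=
  ∀ j : Fin n, mvpRun α j = some (π j)

end MVPPark

namespace MVPPark

lemma mvpStep_castSucc {m : ℕ} {s' : Fin (m + 1) → Option (Fin (m + 1))}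
    {s : Fin m → Option (Fin m)} (h : ∀ j, s' j.castSucc = (s j).map Fin.castSucc)
    (c p j : Fin m) :
    mvpStep s' c.castSucc p.castSucc j.castSucc = (mvpStep s c p j).map Fin.castSucc := by
  unfold mvpStep
  rw [h p]
  cases hp : s p with
  | none =>
    simp only [Option.map_none, Function.update_apply, Fin.castSucc_inj, h]
    split_ifs <;> rfl
  | some i =>
    have hq : ((fun k : Fin (m + 1) => decide (p.castSucc < k) && (s' k).isNone) ∘ Fin.castSucc)
        = fun k => decide (p < k) && (s k).isNone := by
      funext k
      simp [h]
    simp only [Option.map_some, List.finRange_succ_last, List.find?_append, List.find?_map, hq]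
    cases hf : (List.finRange m).find? (fun k => decide (p < k) && (s k).isNone) with
    | some k =>
      simp only [Option.map_some, Option.some_or, Function.update_apply, Fin.castSucc_inj, h]
      split_ifs <;> rfl
    | none =>
      simp only [Option.map_none, Option.none_or]
      cases hl : [Fin.last m].find? (fun k => decide (p.castSucc < k) && (s' k).isNone) with
      | none =>
        simp only [Function.update_apply, Fin.castSucc_inj, h]
        split_ifs <;> rfl
      | some k =>
        obtain rfl : k = Fin.last m := by simpa using List.mem_of_find?_eq_some hl
        simp only [Function.update_apply, Fin.castSucc_inj, h, Fin.castSucc_ne_last, if_false]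
        split_ifs <;> rfl

lemma mvpStep_cases {n : ℕ} (s : Fin n → Option (Fin n)) (c p : Fin n) :
    mvpStep s c p = Function.update s p (some c) ∨
      ∃ i k, s p = some i ∧ p < k ∧
        mvpStep s c p = Function.update (Function.update s p (some c)) k (some i) := by
  unfold mvpStep
  cases hp : s p with
  | none => exact Or.inl rfl
  | some i =>
    cases hf : (List.finRange n).find? (fun k => decide (p < k) && (s k).isNone) with
    | none => exact Or.inl rfl
    | some k =>
      have hk := List.find?_some hf
      simp only [Bool.and_eq_true, decide_eq_true_eq] at hk
      exact Or.inr ⟨i, k, rfl, hk.1, rfl⟩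

lemma mvpStep_self {n : ℕ} (s : Fin n → Option (Fin n)) (c p : Fin n) :
    mvpStep s c p p = some c := by
  obtain h | ⟨i, k, -, hk, h⟩ := mvpStep_cases s c p
  · rw [h, Function.update_self]
  · rw [h, Function.update_of_ne hk.ne, Function.update_self]

lemma mvpStep_last {m : ℕ} (s : Fin (m + 1) → Option (Fin (m + 1))) (c : Fin (m + 1)) :
    mvpStep s c (Fin.last m) = Function.update s (Fin.last m) (some c) := by
  obtain h | ⟨i, k, -, hk, -⟩ := mvpStep_cases s c (Fin.last m)
  · exact h
  · exact absurd hk (Fin.le_last k).not_gt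

lemma mvpStep_isSome {n : ℕ} {s : Fin n → Option (Fin n)} (c p : Fin n) {j : Fin n}
    (hj : (s j).isSome) : (mvpStep s c p j).isSome := by
  obtain h | ⟨i, k, -, -, h⟩ := mvpStep_cases s c p <;>
  · simp only [h, Function.update_apply]
    split_ifs <;> simp [hj]

/-- The set of occupied spots of a state. -/
def occupied {n : ℕ} (s : Fin n → Option (Fin n)) : Finset (Fin n) :=
  univ.filter fun j => (s j).isSome

lemma mem_occupied {n : ℕ} {s : Fin n → Option (Fin n)} {j : Fin n} :
    j ∈ occupied s ↔ (s j).isSome := by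
  simp [occupied]

lemma occupied_update_some {n : ℕ} (s : Fin n → Option (Fin n)) (p c : Fin n) :
    occupied (Function.update s p (some c)) = insert p (occupied s) := by
  ext j
  by_cases hj : j = p <;> simp [mem_occupied, hj]

lemma card_occupied_mvpStep_le {n : ℕ} (s : Fin n → Option (Fin n)) (c p : Fin n) :
    (occupied (mvpStep s c p)).card ≤ (occupied s).card + 1 := by
  obtain h | ⟨i, k, hi, -, h⟩ := mvpStep_cases s c p
  · rw [h, occupied_update_some]
    exact card_insert_le _ _
  · have hp : p ∈ occupied s := by simp [mem_occupied, hi]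
    rw [h, occupied_update_some, occupied_update_some, insert_eq_of_mem hp]
    exact card_insert_le _ _

/-- The state reached from `s` after the cars in `l` enter in order with preferences `α`. -/
def runList {n : ℕ} (α : Fin n → Fin n) (l : List (Fin n)) (s : Fin n → Option (Fin n)) :
    Fin n → Option (Fin n) :=
  l.foldl (fun st c => mvpStep st c (α c)) s

lemma card_occupied_runList_le {n : ℕ} (α : Fin n → Fin n) (l : List (Fin n))
    (s : Fin n → Option (Fin n)) :
    (occupied (runList α l s)).card ≤ (occupied s).card + l.length := by
  induction l generalizing s with
  | nil => simp [runList]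
  | cons c l ih =>
    have h₁ := ih (mvpStep s c (α c))
    have h₂ := card_occupied_mvpStep_le s c (α c)
    change (occupied (runList α l (mvpStep s c (α c)))).card ≤ _
    rw [List.length_cons]
    omega

lemma runList_isSome {n : ℕ} (α : Fin n → Fin n) (l : List (Fin n))
    {s : Fin n → Option (Fin n)} {j : Fin n} (hj : (s j).isSome) :
    (runList α l s j).isSome := by
  induction l generalizing s with
  | nil => exact hj
  | cons c l ih => exact ih (mvpStep_isSome c (α c) hj)

lemma runList_isSome_of_mem {n : ℕ} (α : Fin n → Fin n) {l : List (Fin n)}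
    (s : Fin n → Option (Fin n)) {c : Fin n} (hc : c ∈ l) :
    (runList α l s (α c)).isSome := by
  induction l generalizing s with
  | nil => simp at hc
  | cons d l ih =>
    rcases List.mem_cons.1 hc with rfl | hc
    · exact runList_isSome α l (s := mvpStep s c (α c)) (by rw [mvpStep_self]; rfl)
    · exact ih (mvpStep s d (α d)) hc

lemma mvpRun_succ {m : ℕ} (α : Fin (m + 1) → Fin (m + 1)) :
    mvpRun α = mvpStep (runList α ((List.finRange m).map Fin.castSucc) fun _ => none)
      (Fin.last m) (α (Fin.last m)) := by
  simp [mvpRun, runList, List.finRange_succ_last, List.foldl_append]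

lemma runList_map_castSucc {m : ℕ} {α' : Fin (m + 1) → Fin (m + 1)} {α : Fin m → Fin m}
    (hα : ∀ c, α' c.castSucc = (α c).castSucc) (l : List (Fin m))
    {s' : Fin (m + 1) → Option (Fin (m + 1))} {s : Fin m → Option (Fin m)}
    (h : ∀ j, s' j.castSucc = (s j).map Fin.castSucc) (j : Fin m) :
    runList α' (l.map Fin.castSucc) s' j.castSucc = (runList α l s j).map Fin.castSucc := by
  induction l generalizing s' s with
  | nil => exact h j
  | cons c l ih =>
    refine ih (s' := mvpStep s' c.castSucc (α' c.castSucc)) (s := mvpStep s c (α c)) fun i => ?_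
    rw [hα]
    exact mvpStep_castSucc h c (α c) i

/-- Add one spot and one car, which prefers the new spot. -/
def extend {m : ℕ} (α : Fin m → Fin m) : Fin (m + 1) → Fin (m + 1) :=
  Fin.snoc (α := fun _ => Fin (m + 1)) (fun c => (α c).castSucc) (Fin.last m)

@[simp] lemma extend_castSucc {m : ℕ} (α : Fin m → Fin m) (c : Fin m) :
    extend α c.castSucc = (α c).castSucc := by
  simp [extend]

@[simp] lemma extend_last {m : ℕ} (α : Fin m → Fin m) :
    extend α (Fin.last m) = Fin.last m := by
  simp [extend]

lemma extend_injective {m : ℕ} : Function.Injective (extend (m := m)) := by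
  intro α β h
  funext c
  simpa using congrFun h c.castSucc

lemma mvpOutcome_extend_iff {m : ℕ} {π' : Equiv.Perm (Fin (m + 1))} {π : Equiv.Perm (Fin m)}
    (hcast : ∀ j, π' j.castSucc = (π j).castSucc) (hlast : π' (Fin.last m) = Fin.last m)
    (α : Fin m → Fin m) : MvpOutcome (extend α) π' ↔ MvpOutcome α π := by
  have hrun : ∀ j : Fin m, mvpRun (extend α) j.castSucc = (mvpRun α j).map Fin.castSucc := by
    intro j
    rw [mvpRun_succ, extend_last, mvpStep_last,
      Function.update_of_ne (Fin.castSucc_ne_last j)]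
    exact runList_map_castSucc (extend_castSucc α) _ (fun _ => rfl) j
  have hinj := Option.map_injective (Fin.castSucc_injective m)
  have key : ∀ j : Fin m,
      mvpRun (extend α) j.castSucc = some (π' j.castSucc) ↔ mvpRun α j = some (π j) := by
    intro j
    rw [hrun, hcast, ← Option.map_some (f := Fin.castSucc), hinj.eq_iff]
  refine ⟨fun h j => (key j).1 (h _), fun h j => ?_⟩
  induction j using Fin.lastCases with
  | last => rw [mvpRun_succ, extend_last, mvpStep_self, hlast]
  | cast j => exact (key j).2 (h j)

lemma exists_extend_eq {m : ℕ} {π' : Equiv.Perm (Fin (m + 1))}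
    (hlast : π' (Fin.last m) = Fin.last m) {α' : Fin (m + 1) → Fin (m + 1)}
    (h : MvpOutcome α' π') : ∃ α, extend α = α' := by
  have hα : α' (Fin.last m) = Fin.last m := by
    have h₁ := h (α' (Fin.last m))
    rw [mvpRun_succ, mvpStep_self, Option.some_inj] at h₁
    exact π'.injective (h₁.symm.trans hlast.symm)
  have hne : ∀ c : Fin m, α' c.castSucc ≠ Fin.last m := by
    intro c hc
    have hocc := runList_isSome_of_mem α' (fun _ => none)
      (List.mem_map_of_mem (f := Fin.castSucc) (List.mem_finRange c))
    have hle := card_occupied_runList_le α' ((List.finRange m).map Fin.castSucc) fun _ => none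
    have hempty : occupied (fun _ : Fin (m + 1) => none) = ∅ := by simp [occupied]
    have hfull : occupied (mvpRun α') = univ := by
      ext j
      simp [mem_occupied, h j]
    rw [hc, ← mem_occupied] at hocc
    rw [mvpRun_succ, hα, mvpStep_last, occupied_update_some, insert_eq_of_mem hocc] at hfull
    rw [hfull, hempty] at hle
    simp at hle
  refine ⟨fun c => (α' c.castSucc).castPred (hne c), funext fun j => ?_⟩
  induction j using Fin.lastCases with
  | last => rw [extend_last, hα]
  | cast j => simp

lemma card_fiber_succ {m : ℕ} {π' : Equiv.Perm (Fin (m + 1))} {π : Equiv.Perm (Fin m)}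
    (hcast : ∀ j, π' j.castSucc = (π j).castSucc) (hlast : π' (Fin.last m) = Fin.last m) :
    Nat.card {α // MvpOutcome α π'} = Nat.card {α // MvpOutcome α π} := by
  symm
  refine Nat.card_congr (Equiv.ofBijective
    (fun α => ⟨extend α.1, (mvpOutcome_extend_iff hcast hlast α.1).2 α.2⟩) ⟨?_, ?_⟩)
  · intro α β hαβ
    exact Subtype.ext (extend_injective (congrArg Subtype.val hαβ))
  · rintro ⟨α', hα'⟩
    obtain ⟨α, rfl⟩ := exists_extend_eq hlast hα'
    exact ⟨⟨α, (mvpOutcome_extend_iff hcast hlast α).1 hα'⟩, rfl⟩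

lemma exists_perm_castSucc {m : ℕ} {π' : Equiv.Perm (Fin (m + 1))}
    (hlast : π' (Fin.last m) = Fin.last m) :
    ∃ σ : Equiv.Perm (Fin m), ∀ j, π' j.castSucc = (σ j).castSucc := by
  have hne : ∀ j : Fin m, π' j.castSucc ≠ Fin.last m := fun j hj =>
    Fin.castSucc_ne_last j (π'.injective (hj.trans hlast.symm))
  have hinj : Function.Injective fun j : Fin m => (π' j.castSucc).castPred (hne j) := by
    intro i j hij
    simpa using hij
  exact ⟨Equiv.ofBijective _ (Finite.injective_iff_bijective.1 hinj), fun j => by simp⟩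

end MVPPark

open MVPPark in
/-- Appending an increasing tail to `π` does not change the size of the fiber of the
MVP outcome map. -/
theorem fiber_increasing_tail (m n : ℕ) (hn : 1 ≤ n) (hnm : n < m)
    (π : Equiv.Perm (Fin n)) (π' : Equiv.Perm (Fin m))
    (hhead : ∀ j : Fin m, (hj : j.1 < n) → ((π' j).1 = (π ⟨j.1, hj⟩).1))
    (htail : ∀ j : Fin m, n ≤ j.1 → π' j = j) :
    Nat.card {α : Fin m → Fin m // MvpOutcome α π'} =
      Nat.card {α : Fin n → Fin n // MvpOutcome α π} := by
  clear hn
  replace hnm := hnm.le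
  induction m, hnm using Nat.le_induction with
  | base =>
    obtain rfl : π' = π := Equiv.ext fun j => Fin.ext (hhead j j.2)
    rfl
  | succ m hm ih =>
    have hlast : π' (Fin.last m) = Fin.last m := htail _ hm
    obtain ⟨σ, hσ⟩ := exists_perm_castSucc hlast
    rw [card_fiber_succ hσ hlast]
    refine ih σ (fun j hj => ?_) (fun j hj => ?_)
    · exact (congrArg Fin.val (hσ j)).symm.trans (hhead j.castSucc hj)
    · exact Fin.castSucc_injective m ((hσ j).symm.trans (htail j.castSucc hj))
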